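/- (Existence of almost-analytic extensions) Let f ∈ C^∞(ℝⁿ) be bounded together with all its derivatives. Then there exists f̃ ∈ C^∞(ℝⁿ × ℝⁿ) such that f̃(x,0) = f(x) for all x, and for every multi-index α ∈ ℤ₊^{2n} and every N ∈ ℕ, ∂^α((∂/∂x + i ∂/∂y) f̃)(x,y) = O(|y|^N) as |y| → 0, uniformly in x. -/

import Mathlib

open Real Set

open scoped ContDiff Topology

namespace AlmostAnalytic

section Bounds

variable {P Q F : Type*} [NormedAddCommGroup P] [NormedSpace ℝ P] [NormedAddCommGroup Q]
  [NormedSpace ℝ Q] [NormedAddCommGroup F] [NormedSpace ℝ F]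

/-- All iterated derivatives of `g` are bounded on `s`. -/
def BoundedDerivsOn (g : P → F) (s : Set P) : Prop :=
  ∀ m : ℕ, ∃ C, ∀ p ∈ s, ‖iteratedFDeriv ℝ m g p‖ ≤ C

theorem norm_iteratedFDeriv_succ_clm_le (L : P →L[ℝ] F) (m : ℕ) (p : P) :
    ‖iteratedFDeriv ℝ (m + 1) L p‖ ≤ ‖L‖ := by
  rw [← norm_iteratedFDeriv_fderiv]
  have h : fderiv ℝ L = fun _ => L := funext fun q => L.fderiv
  rw [h]
  cases m with
  | zero => simp
  | succ m => simp [iteratedFDeriv_const_of_ne (Nat.succ_ne_zero m)]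

theorem BoundedDerivsOn.exists_le {g : P → F} {s : Set P} (hg : BoundedDerivsOn g s) (m : ℕ) :
    ∃ C, 1 ≤ C ∧ ∀ i ≤ m, ∀ p ∈ s, ‖iteratedFDeriv ℝ i g p‖ ≤ C := by
  choose C hC using hg
  refine ⟨1 + ∑ i ∈ Finset.range (m + 1), |C i|, ?_, fun i hi p hp => ?_⟩
  · linarith [Finset.sum_nonneg fun i (_ : i ∈ Finset.range (m + 1)) => abs_nonneg (C i)]
  · have h := Finset.single_le_sum (f := fun i => |C i|) (fun i _ => abs_nonneg (C i))
      (Finset.mem_range.2 (Nat.lt_succ_of_le hi))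
    linarith [hC i p hp, le_abs_self (C i)]

theorem BoundedDerivsOn.fderiv {g : P → F} {s : Set P} (hg : BoundedDerivsOn g s) :
    BoundedDerivsOn (fderiv ℝ g) s := fun m => by
  simpa only [norm_iteratedFDeriv_fderiv] using hg (m + 1)

theorem BoundedDerivsOn.clm_comp {g : P → F} {s : Set P} (hg : BoundedDerivsOn g s)
    (hg' : ContDiff ℝ ∞ g) (L : F →L[ℝ] Q) : BoundedDerivsOn (L ∘ g) s := fun m => by
  obtain ⟨C, hC⟩ := hg m
  refine ⟨‖L‖ * C, fun p hp => ?_⟩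
  exact (L.norm_iteratedFDeriv_comp_left hg'.contDiffAt (mod_cast le_top)).trans
    (mul_le_mul_of_nonneg_left (hC p hp) (norm_nonneg _))

theorem BoundedDerivsOn.clm_apply {g : P → Q →L[ℝ] F} {u : P → Q} {s : Set P}
    (hg : BoundedDerivsOn g s) (hg' : ContDiff ℝ ∞ g) (hu : BoundedDerivsOn u s)
    (hu' : ContDiff ℝ ∞ u) : BoundedDerivsOn (fun p => g p (u p)) s := fun m => by
  obtain ⟨C, hC1, hC⟩ := hg.exists_le m
  obtain ⟨D, hD1, hD⟩ := hu.exists_le m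
  refine ⟨∑ i ∈ Finset.range (m + 1), (m.choose i) * C * D, fun p hp => ?_⟩
  refine (norm_iteratedFDeriv_clm_apply hg' hu' p (mod_cast le_top)).trans
    (Finset.sum_le_sum fun i hi => ?_)
  have h1 := hC i (Nat.lt_succ_iff.1 (Finset.mem_range.1 hi)) p hp
  have h2 := hD (m - i) (Nat.sub_le _ _) p hp
  gcongr

/-- The inner function need not be bounded itself, only its derivatives of positive order. -/
theorem BoundedDerivsOn.comp {g : Q → F} {u : P → Q} {s : Set Q} {t : Set P}
    (hg : BoundedDerivsOn g s) (hg' : ContDiff ℝ ∞ g) (hu : BoundedDerivsOn (_root_.fderiv ℝ u) t)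
    (hu' : ContDiff ℝ ∞ u) (hst : MapsTo u t s) : BoundedDerivsOn (g ∘ u) t := fun m => by
  obtain ⟨C, hC1, hC⟩ := hg.exists_le m
  obtain ⟨D, hD1, hD⟩ := hu.exists_le m
  refine ⟨m.factorial * C * D ^ m, fun p hp => ?_⟩
  refine norm_iteratedFDeriv_comp_le hg' hu' (mod_cast le_top) p
    (fun i hi => hC i hi _ (hst hp)) fun i hi1 hi => ?_
  obtain ⟨j, rfl⟩ := Nat.exists_eq_add_of_le' hi1
  rw [← norm_iteratedFDeriv_fderiv]
  exact (hD j (by omega) p hp).trans (le_self_pow₀ hD1 (by omega))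

theorem norm_iteratedFDeriv_comp_clm_le {g : Q → F} (hg : ContDiff ℝ ∞ g) (L : P →L[ℝ] Q)
    (m : ℕ) (p : P) :
    ‖iteratedFDeriv ℝ m (g ∘ L) p‖ ≤ ‖iteratedFDeriv ℝ m g (L p)‖ * ‖L‖ ^ m := by
  rw [L.iteratedFDeriv_comp_right hg p (mod_cast le_top)]
  exact (ContinuousMultilinearMap.norm_compContinuousLinearMap_le _ _).trans_eq (by simp)

theorem BoundedDerivsOn.clm {s : Set P} (L : P →L[ℝ] F) (hs : ∃ C, ∀ p ∈ s, ‖L p‖ ≤ C) :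
    BoundedDerivsOn L s := fun m => by
  cases m with
  | zero => simpa using hs
  | succ m => exact ⟨‖L‖, fun p _ => norm_iteratedFDeriv_succ_clm_le L m p⟩

end Bounds

section Flat

variable {E F : Type*} [NormedAddCommGroup E] [NormedSpace ℝ E]
  [NormedAddCommGroup F] [NormedSpace ℝ F]

/-- Taylor estimate: a function all of whose derivatives are bounded and vanish on `y = 0` is
`O(‖y‖ ^ N)` together with its derivatives. -/
theorem exists_norm_iteratedFDeriv_le_pow {h : E × E → F} (hh : ContDiff ℝ ∞ h)
    (hb : BoundedDerivsOn h univ) (h0 : ∀ (m : ℕ) (x : E), iteratedFDeriv ℝ m h (x, 0) = 0)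
    (N m : ℕ) : ∃ C > (0 : ℝ), ∀ x y, ‖iteratedFDeriv ℝ m h (x, y)‖ ≤ C * ‖y‖ ^ N := by
  induction N generalizing m with
  | zero =>
    obtain ⟨C, hC1, hC⟩ := hb.exists_le m
    exact ⟨C, by linarith, fun x y => by simpa using hC m le_rfl (x, y) (mem_univ _)⟩
  | succ N ih =>
    obtain ⟨C, hC0, hC⟩ := ih (m + 1)
    refine ⟨C, hC0, fun x y => ?_⟩
    have hconv : Convex ℝ ((univ : Set E) ×ˢ Metric.closedBall (0 : E) ‖y‖) :=
      convex_univ.prod (convex_closedBall _ _)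
    have key := hconv.norm_image_sub_le_of_norm_fderiv_le (𝕜 := ℝ)
      (f := iteratedFDeriv ℝ m h) (C := C * ‖y‖ ^ N) (x := (x, 0)) (y := (x, y))
      (fun p _ => (hh.differentiable_iteratedFDeriv (m := m)
        (mod_cast WithTop.coe_lt_top _)) p)
      (fun p hp => by
        rw [norm_fderiv_iteratedFDeriv]
        refine (hC p.1 p.2).trans ?_
        have : ‖p.2‖ ≤ ‖y‖ := by simpa using hp
        gcongr) (by simp) (by simp)
    rw [h0, sub_zero] at key
    refine key.trans_eq ?_
    simp [Prod.norm_def, pow_succ, mul_assoc]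

/-- Multiplication of the second variable by `t`. -/
noncomputable def scaleSnd (E : Type*) [NormedAddCommGroup E] [NormedSpace ℝ E] (t : ℝ) :
    E × E →L[ℝ] E × E :=
  (ContinuousLinearMap.id ℝ E).prodMap (t • ContinuousLinearMap.id ℝ E)

@[simp]
theorem scaleSnd_apply (t : ℝ) (p : E × E) : scaleSnd E t p = (p.1, t • p.2) := rfl

theorem norm_scaleSnd_le {t : ℝ} (ht : 1 ≤ t) : ‖scaleSnd E t‖ ≤ t := by
  refine ContinuousLinearMap.opNorm_le_bound _ (by linarith) fun p => ?_
  rw [scaleSnd_apply, Prod.norm_def, norm_smul, Real.norm_of_nonneg (by linarith)]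
  refine max_le ?_ (mul_le_mul_of_nonneg_left (norm_snd_le p) (by linarith))
  exact (norm_fst_le p).trans (le_mul_of_one_le_left (norm_nonneg p) ht)

theorem iteratedFDeriv_eq_zero_of_homogeneous {v : E × E → F} (hv : ContDiff ℝ ∞ v) {k : ℕ}
    (hk : ∀ (t : ℝ) (p : E × E), v (scaleSnd E t p) = t ^ k • v p) {m : ℕ} (hm : m < k) (x : E) :
    iteratedFDeriv ℝ m v (x, 0) = 0 := by
  set A := ‖iteratedFDeriv ℝ m v (x, 0)‖ with hA
  have hbound : ∀ t : ℝ, 1 ≤ t → t * A ≤ A := fun t ht => by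
    have ht0 : 0 < t := by linarith
    have h1 := norm_iteratedFDeriv_comp_clm_le hv (scaleSnd E t) m (x, 0)
    have h2 : v ∘ scaleSnd E t = t ^ k • v := funext fun p => hk t p
    rw [h2, iteratedFDeriv_const_smul_apply (hv.of_le (mod_cast le_top)).contDiffAt, norm_smul,
      scaleSnd_apply, smul_zero, Real.norm_of_nonneg (by positivity), ← hA] at h1
    have h3 : t ^ (m + 1) * A ≤ A * t ^ m :=
      (mul_le_mul_of_nonneg_right (pow_le_pow_right₀ ht hm) (norm_nonneg _)).trans <| h1.trans <|
        mul_le_mul_of_nonneg_left (pow_le_pow_left₀ (norm_nonneg _) (norm_scaleSnd_le ht) m)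
          (norm_nonneg _)
    refine le_of_mul_le_mul_left ?_ (pow_pos ht0 m)
    calc t ^ m * (t * A) = t ^ (m + 1) * A := by ring
      _ ≤ A * t ^ m := h3
      _ = t ^ m * A := mul_comm _ _
  have h := hbound 2 one_le_two
  exact norm_le_zero_iff.1 (by linarith)

end Flat

section Taylor

variable {E : Type*} [NormedAddCommGroup E] [NormedSpace ℝ E]

/-- The `k`-th directional derivative `∂_sᵏ f (x + s y)` at `s = 0`, as a function of `(x, y)`. -/
noncomputable def dirDeriv (f : E → ℂ) : ℕ → E × E → ℂ
  | 0 => f ∘ Prod.fst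
  | k + 1 => fun p => fderiv ℝ (dirDeriv f k) p (p.2, 0)

variable {f : E → ℂ}

/-- The map `(x, y) ↦ (y, 0)`. -/
noncomputable def sndInl (E : Type*) [NormedAddCommGroup E] [NormedSpace ℝ E] :
    E × E →L[ℝ] E × E :=
  (ContinuousLinearMap.inl ℝ E E).comp (ContinuousLinearMap.snd ℝ E E)

@[simp]
theorem sndInl_apply (p : E × E) : sndInl E p = (p.2, 0) := rfl

theorem dirDeriv_succ (k : ℕ) (p : E × E) :
    dirDeriv f (k + 1) p = fderiv ℝ (dirDeriv f k) p (sndInl E p) := rfl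

theorem contDiff_dirDeriv (hf : ContDiff ℝ ∞ f) (k : ℕ) : ContDiff ℝ ∞ (dirDeriv f k) := by
  induction k with
  | zero => exact hf.comp contDiff_fst
  | succ k ih => exact (ih.fderiv_right (m := ∞) (by simp)).clm_apply (sndInl E).contDiff

theorem differentiable_fderiv_dirDeriv (hf : ContDiff ℝ ∞ f) (k : ℕ) :
    Differentiable ℝ (fderiv ℝ (dirDeriv f k)) :=
  ((contDiff_dirDeriv hf k).fderiv_right (m := ∞) (by simp)).differentiable (by simp)

theorem boundedDerivsOn_dirDeriv (hf : ContDiff ℝ ∞ f) (hb : BoundedDerivsOn f univ) (R : ℝ)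
    (k : ℕ) : BoundedDerivsOn (dirDeriv f k) {p | ‖p.2‖ ≤ R} := by
  induction k with
  | zero =>
    refine BoundedDerivsOn.comp hb hf (fun m => ?_) contDiff_fst (mapsTo_univ _ _)
    refine ⟨‖ContinuousLinearMap.fst ℝ E E‖, fun p _ => ?_⟩
    rw [norm_iteratedFDeriv_fderiv]
    exact norm_iteratedFDeriv_succ_clm_le (ContinuousLinearMap.fst ℝ E E) m p
  | succ k ih =>
    exact ih.fderiv.clm_apply ((contDiff_dirDeriv hf k).fderiv_right (m := ∞) (by simp))
      (.clm (sndInl E) ⟨R, fun p hp => by simpa [Prod.norm_def] using hp⟩) (sndInl E).contDiff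

theorem dirDeriv_scaleSnd (hf : ContDiff ℝ ∞ f) (k : ℕ) (t : ℝ) (p : E × E) :
    dirDeriv f k (scaleSnd E t p) = t ^ k • dirDeriv f k p := by
  induction k generalizing p with
  | zero => simp [dirDeriv]
  | succ k ih =>
    have hd := (contDiff_dirDeriv hf k).differentiable (by simp)
    have h1 : dirDeriv f k ∘ scaleSnd E t = t ^ k • dirDeriv f k := funext ih
    have h2 := congrArg (fun g => fderiv ℝ g p (p.2, 0)) h1
    simp only [fderiv_const_smul (hd p), fderiv_comp p (hd _) (scaleSnd E t).differentiableAt,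
      ContinuousLinearMap.fderiv, ContinuousLinearMap.comp_apply, scaleSnd_apply,
      smul_zero, FunLike.coe_smul, Pi.smul_apply] at h2
    have h3 : ((t • p.2, 0) : E × E) = t • (p.2, 0) := by simp
    rw [dirDeriv_succ, dirDeriv_succ, sndInl_apply, sndInl_apply, scaleSnd_apply, h3, map_smul, h2,
      pow_succ', mul_smul]

theorem fderiv_dirDeriv_succ (hf : ContDiff ℝ ∞ f) (k : ℕ) (p w : E × E) :
    fderiv ℝ (dirDeriv f (k + 1)) p w =
      fderiv ℝ (fderiv ℝ (dirDeriv f k)) p w (p.2, 0) + fderiv ℝ (dirDeriv f k) p (w.2, 0) := by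
  have h : dirDeriv f (k + 1) = fun q => fderiv ℝ (dirDeriv f k) q (sndInl E q) := rfl
  rw [h, fderiv_clm_apply (differentiable_fderiv_dirDeriv hf k p) (sndInl E).differentiableAt]
  simp [add_comm]

theorem fderiv_fderiv_dirDeriv_comm (hf : ContDiff ℝ ∞ f) (k : ℕ) (p v w : E × E) :
    fderiv ℝ (fderiv ℝ (dirDeriv f k)) p v w = fderiv ℝ (fderiv ℝ (dirDeriv f k)) p w v :=
  (contDiff_dirDeriv hf k).contDiffAt.isSymmSndFDerivAt
    (by rw [minSmoothness_of_isRCLikeNormedField]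
        exact WithTop.coe_le_coe.2 (le_top : (2 : ℕ∞) ≤ ⊤)) v w

theorem fderiv_dirDeriv_zero_inr (hf : ContDiff ℝ ∞ f) (p : E × E) (e : E) :
    fderiv ℝ (dirDeriv f 0) p (0, e) = 0 := by
  have h : dirDeriv f 0 = f ∘ ContinuousLinearMap.fst ℝ E E := rfl
  rw [h, fderiv_comp p (hf.differentiable (by simp) _)
    (ContinuousLinearMap.fst ℝ E E).differentiableAt]
  simp [fderiv_fst]

theorem fderiv_dirDeriv_succ_inr (hf : ContDiff ℝ ∞ f) (k : ℕ) (p : E × E) (e : E) :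
    fderiv ℝ (dirDeriv f (k + 1)) p (0, e) = (k + 1 : ℂ) * fderiv ℝ (dirDeriv f k) p (e, 0) := by
  have apply_const : ∀ (j : ℕ) (q v w : E × E), fderiv ℝ (fderiv ℝ (dirDeriv f j)) q v w =
      fderiv ℝ (fun r => fderiv ℝ (dirDeriv f j) r w) q v := fun j q v w => by
    rw [fderiv_clm_apply (differentiable_fderiv_dirDeriv hf j q) (differentiableAt_const w)]
    simp
  induction k generalizing p with
  | zero =>
    rw [fderiv_dirDeriv_succ hf, fderiv_fderiv_dirDeriv_comm hf, apply_const]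
    simp [fderiv_dirDeriv_zero_inr hf]
  | succ k ih =>
    rw [fderiv_dirDeriv_succ hf (k + 1), fderiv_fderiv_dirDeriv_comm hf, apply_const]
    simp only [ih]
    rw [fderiv_const_mul ((differentiable_fderiv_dirDeriv hf k p).clm_apply
        (differentiableAt_const _)), FunLike.coe_smul, Pi.smul_apply, ← apply_const,
      fderiv_fderiv_dirDeriv_comm hf]
    have h := fderiv_dirDeriv_succ hf k p (e, 0)
    simp only [show ((0, 0) : E × E) = 0 from rfl, map_zero, add_zero] at h
    rw [← h]
    push_cast
    simp only [smul_eq_mul]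
    ring

end Taylor

section CauchyRiemann

variable {E : Type*} [NormedAddCommGroup E] [NormedSpace ℝ E] {f : E → ℂ}

/-- The Cauchy–Riemann symbol `A ↦ A (e, 0) + i A (0, e)`. -/
noncomputable def crMap (e : E) : (E × E →L[ℝ] ℂ) →L[ℝ] ℂ :=
  ContinuousLinearMap.apply ℝ ℂ (e, 0) + Complex.I • ContinuousLinearMap.apply ℝ ℂ (0, e)

@[simp]
theorem crMap_apply (e : E) (A : E × E →L[ℝ] ℂ) :
    crMap e A = A (e, 0) + Complex.I * A (0, e) := rfl

/-- The degree `k` term `(iᵏ / k!) Dᵏf(x)[y, …, y]` of the formal extension. -/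
noncomputable def taylorTerm (f : E → ℂ) (k : ℕ) : E × E → ℂ :=
  (Complex.I ^ k / (k.factorial : ℂ)) • dirDeriv f k

theorem contDiff_taylorTerm (hf : ContDiff ℝ ∞ f) (k : ℕ) : ContDiff ℝ ∞ (taylorTerm f k) :=
  contDiff_const.smul (contDiff_dirDeriv hf k)

theorem taylorTerm_scaleSnd (hf : ContDiff ℝ ∞ f) (k : ℕ) (t : ℝ) (p : E × E) :
    taylorTerm f k (scaleSnd E t p) = t ^ k • taylorTerm f k p := by
  rw [taylorTerm, Pi.smul_apply, Pi.smul_apply, dirDeriv_scaleSnd hf, smul_comm]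

theorem boundedDerivsOn_taylorTerm (hf : ContDiff ℝ ∞ f) (hb : BoundedDerivsOn f univ) (R : ℝ)
    (k : ℕ) : BoundedDerivsOn (taylorTerm f k) {p | ‖p.2‖ ≤ R} :=
  (boundedDerivsOn_dirDeriv hf hb R k).clm_comp (contDiff_dirDeriv hf k)
    ((Complex.I ^ k / (k.factorial : ℂ)) • ContinuousLinearMap.id ℝ ℂ)

theorem fderiv_taylorTerm (hf : ContDiff ℝ ∞ f) (k : ℕ) (p w : E × E) :
    fderiv ℝ (taylorTerm f k) p w =
      Complex.I ^ k / (k.factorial : ℂ) * fderiv ℝ (dirDeriv f k) p w := by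
  rw [taylorTerm, fderiv_const_smul ((contDiff_dirDeriv hf k).differentiable (by simp) p)]
  rfl

/-- The Cauchy–Riemann derivative of the partial sums telescopes. -/
theorem crMap_fderiv_sum_taylorTerm (hf : ContDiff ℝ ∞ f) (e : E) (K : ℕ) (p : E × E) :
    crMap e (fderiv ℝ (∑ k ∈ Finset.range (K + 1), taylorTerm f k) p) =
      fderiv ℝ (taylorTerm f K) p (e, 0) := by
  have hd : ∀ k, DifferentiableAt ℝ (taylorTerm f k) p := fun k =>
    (contDiff_taylorTerm hf k).differentiable (by simp) p
  rw [fderiv_sum fun k _ => hd k, map_sum]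
  induction K with
  | zero =>
    simp [fderiv_taylorTerm hf, fderiv_dirDeriv_zero_inr hf]
  | succ K ih =>
    rw [Finset.sum_range_succ, ih, crMap_apply]
    simp only [fderiv_taylorTerm hf, fderiv_dirDeriv_succ_inr hf]
    have h1 : (K.factorial : ℂ) ≠ 0 := mod_cast K.factorial_ne_zero
    have h2 : (K + 1 : ℂ) ≠ 0 := mod_cast K.succ_ne_zero
    rw [Nat.factorial_succ, pow_succ]
    push_cast
    field_simp
    linear_combination ((K + 1) * (fderiv ℝ (dirDeriv f K) p) (e, 0)) * Complex.I_sq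

theorem iteratedFDeriv_crMap_fderiv_eq_zero {g : E × E → ℂ} (hf : ContDiff ℝ ∞ f)
    (hg : ContDiff ℝ ∞ g) {m K : ℕ} (hK : m + 1 < K) (x e : E)
    (hgx : iteratedFDeriv ℝ (m + 1) g (x, 0) =
      iteratedFDeriv ℝ (m + 1) (∑ k ∈ Finset.range (K + 1), taylorTerm f k) (x, 0)) :
    iteratedFDeriv ℝ m (crMap e ∘ fderiv ℝ g) (x, 0) = 0 := by
  set U := ∑ k ∈ Finset.range (K + 1), taylorTerm f k with hU
  have hUs : ContDiff ℝ ∞ U := by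
    rw [hU, show (∑ k ∈ Finset.range (K + 1), taylorTerm f k) =
      fun p => ∑ k ∈ Finset.range (K + 1), taylorTerm f k p from funext fun p => by simp]
    exact ContDiff.sum fun k _ => contDiff_taylorTerm hf k
  have vanish : ∀ (L : (E × E →L[ℝ] ℂ) →L[ℝ] ℂ) (h : E × E → ℂ), ContDiff ℝ ∞ h →
      iteratedFDeriv ℝ (m + 1) h (x, 0) = 0 → iteratedFDeriv ℝ m (L ∘ fderiv ℝ h) (x, 0) = 0 := by
    intro L h hh h0
    have := L.norm_iteratedFDeriv_comp_left (n := m) (x := (x, 0))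
      ((hh.fderiv_right (m := ∞) (by simp)).contDiffAt) (mod_cast le_top)
    rw [norm_iteratedFDeriv_fderiv, h0, norm_zero, mul_zero] at this
    exact norm_le_zero_iff.1 this
  have hsplit : crMap e ∘ fderiv ℝ g = crMap e ∘ fderiv ℝ (g - U) +
      ContinuousLinearMap.apply ℝ ℂ (e, 0) ∘ fderiv ℝ (taylorTerm f K) := by
    funext p
    have h := crMap_fderiv_sum_taylorTerm hf e K p
    rw [Pi.add_apply, Function.comp_apply, Function.comp_apply, Function.comp_apply,
      fderiv_sub (hg.differentiable (by simp) p) (hUs.differentiable (by simp) p), map_sub, h]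
    simp
  have smooth : ∀ (L : (E × E →L[ℝ] ℂ) →L[ℝ] ℂ) (h : E × E → ℂ), ContDiff ℝ ∞ h →
      ContDiffAt ℝ m (L ∘ fderiv ℝ h) (x, 0) := fun L h hh =>
    (L.contDiff.comp (hh.fderiv_right (m := m) (mod_cast le_top))).contDiffAt
  have hgU : ContDiff ℝ ∞ (g - U) := hg.sub hUs
  rw [hsplit, iteratedFDeriv_add_apply (smooth _ _ hgU)
      (smooth _ _ (contDiff_taylorTerm hf K)), vanish _ _ hgU, vanish _ _
      (contDiff_taylorTerm hf K), add_zero]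
  · exact iteratedFDeriv_eq_zero_of_homogeneous (contDiff_taylorTerm hf K)
      (taylorTerm_scaleSnd hf K) hK x
  · rw [iteratedFDeriv_sub_apply (hg.of_le (mod_cast le_top)).contDiffAt
      (hUs.of_le (mod_cast le_top)).contDiffAt, hgx, sub_self]

end CauchyRiemann

section Borel

variable {E F : Type*} [NormedAddCommGroup E] [NormedSpace ℝ E]
  [NormedAddCommGroup F] [NormedSpace ℝ F]

theorem norm_iteratedFDeriv_rescale_le {W : E × E → F} (hW : ContDiff ℝ ∞ W) {t : ℝ} (ht : 1 ≤ t)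
    (k m : ℕ) {C : ℝ} (hC : ∀ p, ‖iteratedFDeriv ℝ m W p‖ ≤ C) (p : E × E) :
    ‖iteratedFDeriv ℝ m ((t ^ k)⁻¹ • (W ∘ scaleSnd E t)) p‖ ≤ (t ^ k)⁻¹ * (C * t ^ m) := by
  have hs : ContDiff ℝ m (W ∘ scaleSnd E t) :=
    (hW.comp (scaleSnd E t).contDiff).of_le (mod_cast le_top)
  rw [iteratedFDeriv_const_smul_apply hs.contDiffAt, norm_smul,
    Real.norm_of_nonneg (by positivity)]
  have hC0 : 0 ≤ C := (norm_nonneg _).trans (hC p)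
  have h1 := norm_iteratedFDeriv_comp_clm_le hW (scaleSnd E t) m p
  have h2 := hC (scaleSnd E t p)
  have h3 := norm_scaleSnd_le (E := E) ht
  gcongr
  exact h1.trans (by gcongr)

/-- Borel summation: suitable rescalings of a sequence of functions with bounded derivatives
have a series that converges uniformly with all derivatives. -/
theorem exists_summable_rescale {W : ℕ → E × E → F} (hW : ∀ k, ContDiff ℝ ∞ (W k))
    (hb : ∀ k, BoundedDerivsOn (W k) univ) :
    ∃ t : ℕ → ℝ, (∀ k, 1 ≤ t k) ∧ ∃ v : ℕ → ℕ → ℝ, (∀ m, Summable (v m)) ∧ ∀ m k p,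
      ‖iteratedFDeriv ℝ m ((t k ^ k)⁻¹ • (W k ∘ scaleSnd E (t k))) p‖ ≤ v m k := by
  choose C hC using hb
  choose B hB1 hB using fun k => BoundedDerivsOn.exists_le (fun m => ⟨C k m, hC k m⟩) k
  have ht : ∀ k, 1 ≤ 2 ^ k * B k := fun k =>
    one_le_mul_of_one_le_of_one_le (one_le_pow₀ one_le_two) (hB1 k)
  set t : ℕ → ℝ := fun k => 2 ^ k * B k with ht_def
  refine ⟨t, ht, fun m k => if k ≤ m then (t k ^ k)⁻¹ * (C k m * t k ^ m) else (1 / 2) ^ k,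
    fun m => ?_, fun m k p => ?_⟩
  · refine (summable_congr_cofinite ?_).2 summable_geometric_two
    rw [Nat.cofinite_eq_atTop]
    filter_upwards [Filter.eventually_gt_atTop m] with k hk
    simp [not_le.2 hk]
  · beta_reduce
    split_ifs with hkm
    · exact norm_iteratedFDeriv_rescale_le (hW k) (ht k) k m (fun q => hC k m q (mem_univ _)) p
    · have hmk : m + 1 ≤ k := not_le.1 hkm
      refine (norm_iteratedFDeriv_rescale_le (hW k) (ht k) k m
        (fun q => hB k m (by omega) q (mem_univ _)) p).trans ?_
      have ht0 : 0 < t k := by linarith [ht k]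
      have h1 : t k ^ (m + 1) ≤ t k ^ k := pow_le_pow_right₀ (ht k) hmk
      rw [inv_mul_le_iff₀ (by positivity)]
      calc B k * t k ^ m = t k ^ (m + 1) * (1 / 2) ^ k := by
            have h2 : (2 : ℝ) ^ k * (1 / 2) ^ k = 1 := by rw [← mul_pow]; norm_num
            rw [pow_succ, show t k ^ m * t k * (1 / 2) ^ k =
              t k ^ m * B k * (2 ^ k * (1 / 2) ^ k) by simp only [ht_def]; ring, h2]
            ring
        _ ≤ t k ^ k * (1 / 2) ^ k := by gcongr

theorem exists_bounded_cutoff_id (E : Type*) [NormedAddCommGroup E] [NormedSpace ℝ E]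
    [FiniteDimensional ℝ E] :
    ∃ ψ : E → E, ContDiff ℝ ∞ ψ ∧ BoundedDerivsOn ψ univ ∧ ψ =ᶠ[𝓝 0] id := by
  let φ : ContDiffBump (0 : E) := ⟨1, 2, one_pos, one_lt_two⟩
  have hs : ContDiff ℝ ∞ fun y => φ y • y := φ.contDiff.smul contDiff_id
  refine ⟨fun y => φ y • y, hs, fun m => ?_, ?_⟩
  · obtain ⟨C, hC⟩ := (hs.continuous_iteratedFDeriv (m := m)
      (mod_cast le_top)).bounded_above_of_compact_support
      ((φ.hasCompactSupport.smul_right (f' := id)).iteratedFDeriv m)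
    exact ⟨C, fun p _ => hC p⟩
  · filter_upwards [φ.eventuallyEq_one] with y hy
    simp [hy]

theorem boundedDerivsOn_fderiv_prodMk_snd {ψ : E → E} (hs : ContDiff ℝ ∞ ψ)
    (hb : BoundedDerivsOn ψ univ) :
    BoundedDerivsOn (fderiv ℝ fun p : E × E => (p.1, ψ p.2)) univ := fun m => by
  obtain ⟨C, hC⟩ := hb (m + 1)
  refine ⟨max ‖ContinuousLinearMap.fst ℝ E E‖ (C * ‖ContinuousLinearMap.snd ℝ E E‖ ^ (m + 1)),
    fun p _ => ?_⟩
  have h2 : ContDiff ℝ (m + 1 : ℕ) fun p : E × E => ψ p.2 :=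
    (hs.comp contDiff_snd).of_le (mod_cast le_top)
  rw [norm_iteratedFDeriv_fderiv, iteratedFDeriv_prodMk contDiff_fst.contDiffAt h2.contDiffAt le_rfl,
    ContinuousMultilinearMap.opNorm_prod]
  refine max_le_max (norm_iteratedFDeriv_succ_clm_le (ContinuousLinearMap.fst ℝ E E) m p) ?_
  refine (norm_iteratedFDeriv_comp_clm_le hs (ContinuousLinearMap.snd ℝ E E) (m + 1) p).trans ?_
  exact mul_le_mul_of_nonneg_right (hC _ (mem_univ _)) (by positivity)

end Borel

/-- Almost-analytic extension on a finite-dimensional space, with flatness on the real subspace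
expressed through global bounds on the Cauchy–Riemann derivatives. -/
theorem exists_extension {E : Type*} [NormedAddCommGroup E] [NormedSpace ℝ E]
    [FiniteDimensional ℝ E] {f : E → ℂ} (hf : ContDiff ℝ ∞ f) (hb : BoundedDerivsOn f univ) :
    ∃ g : E × E → ℂ, ContDiff ℝ ∞ g ∧ (∀ x, g (x, 0) = f x) ∧
      ∀ (e : E) (m N : ℕ), ∃ C > (0 : ℝ), ∀ x y,
        ‖iteratedFDeriv ℝ m (crMap e ∘ fderiv ℝ g) (x, y)‖ ≤ C * ‖y‖ ^ N := by
  obtain ⟨ψ, hψ, hψb, hψ0⟩ := exists_bounded_cutoff_id E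
  obtain ⟨R, hR⟩ := hψb 0
  let Ψ : E × E → E × E := fun p => (p.1, ψ p.2)
  have hΨ : ContDiff ℝ ∞ Ψ := contDiff_fst.prodMk (hψ.comp contDiff_snd)
  have hW : ∀ k, ContDiff ℝ ∞ (taylorTerm f k ∘ Ψ) := fun k => (contDiff_taylorTerm hf k).comp hΨ
  obtain ⟨t, ht, v, hv, hle⟩ := exists_summable_rescale hW fun k =>
    (boundedDerivsOn_taylorTerm hf hb R k).comp (contDiff_taylorTerm hf k)
      (boundedDerivsOn_fderiv_prodMk_snd hψ hψb) hΨ fun p _ => by simpa using hR p.2 (mem_univ _)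
  set G : ℕ → E × E → ℂ := fun k => (t k ^ k)⁻¹ • ((taylorTerm f k ∘ Ψ) ∘ scaleSnd E (t k))
    with hG_def
  have hG : ∀ k, ContDiff ℝ ∞ (G k) := fun k =>
    contDiff_const.smul ((hW k).comp (scaleSnd E (t k)).contDiff)
  have hGeq : ∀ k x, G k =ᶠ[𝓝 (x, 0)] taylorTerm f k := fun k x => by
    have hlim : Filter.Tendsto (fun p : E × E => t k • p.2) (𝓝 (x, 0)) (𝓝 0) := by
      have h : Continuous fun p : E × E => t k • p.2 := by fun_prop
      simpa using h.tendsto (x, 0)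
    filter_upwards [hlim.eventually hψ0] with p hp
    have hp' : Ψ (scaleSnd E (t k) p) = scaleSnd E (t k) p := Prod.ext rfl hp
    have ht0 : t k ^ k ≠ 0 := pow_ne_zero _ (by linarith [ht k])
    simp only [hG_def]
    rw [Pi.smul_apply, Function.comp_apply, Function.comp_apply, hp',
      taylorTerm_scaleSnd hf, inv_smul_smul₀ ht0]
  let g : E × E → ℂ := fun p => ∑' k, G k p
  have hg : ContDiff ℝ ∞ g := contDiff_tsum hG (fun m _ => hv m) fun m k p _ => hle m k p
  have hgD : ∀ m p, iteratedFDeriv ℝ m g p = ∑' k, iteratedFDeriv ℝ m (G k) p := fun m p =>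
    iteratedFDeriv_tsum_apply (N := ⊤) hG (fun m _ => hv m) (fun m k p _ => hle m k p) le_top p
  have hgb : BoundedDerivsOn g univ := fun m => ⟨∑' k, v m k, fun p _ => by
    rw [hgD]
    exact tsum_of_norm_bounded (hv m).hasSum fun k => hle m k p⟩
  have hgU : ∀ (m K : ℕ) (x : E), m ≤ K → iteratedFDeriv ℝ m g (x, 0) =
      iteratedFDeriv ℝ m (∑ k ∈ Finset.range (K + 1), taylorTerm f k) (x, 0) := by
    intro m K x hmK
    rw [hgD, iteratedFDeriv_sum_apply fun k _ =>
      ((contDiff_taylorTerm hf k).of_le (mod_cast le_top)).contDiffAt]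
    rw [tsum_congr fun k => ((hGeq k x).iteratedFDeriv ℝ m).eq_of_nhds]
    refine tsum_eq_sum fun k hk => ?_
    exact iteratedFDeriv_eq_zero_of_homogeneous (contDiff_taylorTerm hf k)
      (taylorTerm_scaleSnd hf k) (by simp at hk; omega) x
  refine ⟨g, hg, fun x => ?_, fun e m N => ?_⟩
  · have h := congrArg (fun A => A 0) (hgU 0 0 x le_rfl)
    simpa [taylorTerm, dirDeriv] using h
  · exact exists_norm_iteratedFDeriv_le_pow ((crMap e).contDiff.comp
      (hg.fderiv_right (m := ∞) (by simp))) (hgb.fderiv.clm_comp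
      (hg.fderiv_right (m := ∞) (by simp)) _) (fun j x =>
        iteratedFDeriv_crMap_fderiv_eq_zero hf hg (K := j + 2) (by omega) x e
          (hgU (j + 1) (j + 2) x (by omega))) N m

end AlmostAnalytic

/-- **Existence of almost-analytic extensions.** For `f ∈ C_b^∞(ℝⁿ)` there is a smooth
`g : ℝⁿ × ℝⁿ → ℂ` with `g(x,0) = f(x)` and such that every derivative of each
Cauchy–Riemann derivative `(∂_{x_i} + i ∂_{y_i}) g` is `O(|y|^N)` for every `N`,
uniformly in `x`, as `|y| → 0`. -/
theorem exists_almost_analytic_extension (n : ℕ) (f : EuclideanSpace ℝ (Fin n) → ℂ)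
    (hf : ContDiff ℝ (⊤ : ℕ∞) f)
    (hbdd : ∀ k : ℕ, ∃ C, ∀ x, ‖iteratedFDeriv ℝ k f x‖ ≤ C) :
    ∃ g : EuclideanSpace ℝ (Fin n) × EuclideanSpace ℝ (Fin n) → ℂ,
      ContDiff ℝ (⊤ : ℕ∞) g ∧ (∀ x, g (x, 0) = f x) ∧
      ∀ (i : Fin n) (α N : ℕ), ∃ C > (0:ℝ), ∀ x y, ‖y‖ ≤ 1 →
        ‖iteratedFDeriv ℝ α
            (fun p => fderiv ℝ g p (EuclideanSpace.single i 1, 0)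
              + Complex.I * fderiv ℝ g p (0, EuclideanSpace.single i 1)) (x, y)‖
          ≤ C * ‖y‖ ^ N := by
  obtain ⟨g, hg, hg0, hcr⟩ := AlmostAnalytic.exists_extension hf
    fun k => (hbdd k).imp fun C hC p _ => hC p
  refine ⟨g, hg, hg0, fun i α N => ?_⟩
  obtain ⟨C, hC0, hC⟩ := hcr (EuclideanSpace.single i 1) α N
  exact ⟨C, hC0, fun x y _ => hC x y⟩
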